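/- For every n ≥ 1 the identity (2n+β+γ)r_n − (2n+α+γ)r*_n + 2r_n r*_n − n(n+γ) = β_n(R_{n−1}R*_n + R_n R*_{n−1}) holds. -/

import Mathlib

open MeasureTheory Real

/-- The generalized Jacobi weight `w(x;t) = (x-t)^γ x^α (1-x)^β`. -/
noncomputable def genJacobiWeight (α β γ t x : ℝ) : ℝ :=
  (x - t) ^ γ * x ^ α * (1 - x) ^ β

open Polynomial in
/-- The moment functional `p ↦ ∫₀¹ p u`, linear in `p` when `u` is integrable. -/
noncomputable def momentFunctional (u : ℝ → ℝ) (hu : IntervalIntegrable u volume 0 1) :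
    ℝ[X] →ₗ[ℝ] ℝ where
  toFun p := ∫ y in (0:ℝ)..1, p.eval y * u y
  map_add' p q := by
    simp only [Polynomial.eval_add, add_mul]
    exact intervalIntegral.integral_add
      (hu.continuousOn_mul p.continuous.continuousOn)
      (hu.continuousOn_mul q.continuous.continuousOn)
  map_smul' c p := by
    simp only [Polynomial.eval_smul, smul_eq_mul, mul_assoc, RingHom.id_apply]
    exact intervalIntegral.integral_const_mul c _

theorem momentFunctional_apply (u : ℝ → ℝ) (hu : IntervalIntegrable u volume 0 1)
    (p : Polynomial ℝ) : momentFunctional u hu p = ∫ y in (0:ℝ)..1, p.eval y * u y := rfl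

theorem momentFunctional_X_sub_C_mul {u w : ℝ → ℝ} (hu : IntervalIntegrable u volume 0 1)
    (hw : IntervalIntegrable w volume 0 1) (c : ℝ)
    (huw : ∀ y ∈ Set.Icc (0:ℝ) 1, (y - c) * u y = w y) (q : Polynomial ℝ) :
    momentFunctional u hu ((Polynomial.X - Polynomial.C c) * q) = momentFunctional w hw q := by
  simp only [momentFunctional_apply]
  refine intervalIntegral.integral_congr fun y hy => ?_
  rw [Set.uIcc_of_le zero_le_one] at hy
  simp only [Polynomial.eval_mul, Polynomial.eval_sub, Polynomial.eval_X, Polynomial.eval_C,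
    ← huw y hy]
  ring

/-- Against the `n`-th monic orthogonal polynomial, a polynomial of degree at most `n` only
sees its `n`-th coefficient. -/
theorem functional_mul_orthogonal {P : ℕ → Polynomial ℝ} {h : ℕ → ℝ}
    (L : Polynomial ℝ →ₗ[ℝ] ℝ)
    (hmonic : ∀ n, (P n).Monic ∧ (P n).natDegree = n)
    (horth : ∀ m n, L (P m * P n) = if m = n then h n else 0)
    (n k : ℕ) (hk : k ≤ n + 1) (q : Polynomial ℝ) (hq : q.degree < k) :
    L (q * P n) = q.coeff n * h n := by
  induction k generalizing q with
  | zero =>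
    have : q = 0 := by simpa using hq
    simp [this]
  | succ k ih =>
    have hPk : (P k).coeff k = 1 := by
      have := (hmonic k).1.coeff_natDegree
      rwa [(hmonic k).2] at this
    have hdeg : (q - Polynomial.C (q.coeff k) * P k).degree < k := by
      rw [Polynomial.degree_lt_iff_coeff_zero] at hq ⊢
      intro m hm
      rcases hm.eq_or_lt with rfl | hlt
      · simp [hPk]
      · rw [Polynomial.coeff_sub, Polynomial.coeff_C_mul, hq m hlt,
          Polynomial.coeff_eq_zero_of_natDegree_lt ((hmonic k).2.trans_lt hlt)]
        simp
    have key := ih (by omega) _ hdeg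
    have hsplit : q * P n = (q - Polynomial.C (q.coeff k) * P k) * P n
        + (q.coeff k) • (P k * P n) := by
      rw [Polynomial.smul_eq_C_mul]; ring
    rw [hsplit, map_add, map_smul, key, horth, Polynomial.coeff_sub, Polynomial.coeff_C_mul]
    split_ifs with hkn
    · subst hkn
      simp [hPk]
    · rw [Polynomial.coeff_eq_zero_of_natDegree_lt (p := P k)
        ((hmonic k).2.trans_lt (by omega))]
      simp

/-- The quadratic relation between consecutive Cauchy-type integrals
`∫ P_j P_k w / (y - c)`. -/
theorem cauchy_functional_quadratic {P : ℕ → Polynomial ℝ} {h : ℕ → ℝ}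
    (L M : Polynomial ℝ →ₗ[ℝ] ℝ) (c : ℝ)
    (hLM : ∀ q, M ((Polynomial.X - Polynomial.C c) * q) = L q)
    (hmonic : ∀ n, (P n).Monic ∧ (P n).natDegree = n)
    (horth : ∀ m n, L (P m * P n) = if m = n then h n else 0) (m : ℕ) :
    M (P m * P (m + 1)) * (M (P m * P (m + 1)) - h m)
      = M (P (m + 1) * P (m + 1)) * M (P m * P m) := by
  have split : ∀ j k : ℕ, j ≤ k + 1 →
      M (P j * P k) = (P j).eval c * M (P k) + if j = k + 1 then h k else 0 := by
    intro j k hjk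
    obtain ⟨q, hq⟩ := Polynomial.X_sub_C_dvd_sub_C_eval (a := c) (p := P j)
    have hP : P j = Polynomial.C ((P j).eval c)
        + (Polynomial.X - Polynomial.C c) * q := by rw [← hq]; ring
    have hM : M (P j * P k) = (P j).eval c * M (P k) + L (q * P k) := by
      have : P j * P k = ((P j).eval c) • P k
          + (Polynomial.X - Polynomial.C c) * (q * P k) := by
        rw [Polynomial.smul_eq_C_mul]
        linear_combination P k * hP
      rw [this, map_add, map_smul, hLM, smul_eq_mul]
    have hcoeff : ∀ i, q.coeff i - c * q.coeff (i + 1) = (P j).coeff (i + 1) := by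
      intro i
      have := congrArg (fun p : Polynomial ℝ => p.coeff (i + 1)) hq
      simp only [sub_mul, Polynomial.coeff_sub, Polynomial.coeff_X_mul,
        Polynomial.coeff_C_mul, Polynomial.coeff_C_succ, sub_zero] at this
      exact this.symm
    have hzero : ∀ i, j ≤ i → q.coeff i = 0 := by
      by_cases hq0 : q = 0
      · simp [hq0]
      intro i hi
      apply Polynomial.coeff_eq_zero_of_natDegree_lt
      by_contra! hge
      have h1 := hcoeff q.natDegree
      rw [Polynomial.coeff_eq_zero_of_natDegree_lt (p := q) (Nat.lt_succ_self _),
        Polynomial.coeff_eq_zero_of_natDegree_lt (p := P j)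
          ((hmonic j).2.trans_lt (by omega))] at h1
      apply hq0
      rw [← Polynomial.leadingCoeff_eq_zero, Polynomial.leadingCoeff]
      linarith
    have hdeg : q.degree < (j : ℕ) := by
      rw [Polynomial.degree_lt_iff_coeff_zero]
      exact hzero
    rw [hM, functional_mul_orthogonal L hmonic horth k j hjk q hdeg]
    split_ifs with hj
    · subst hj
      have h1 := hcoeff k
      have h2 := (hmonic (k + 1)).1.coeff_natDegree
      rw [(hmonic (k + 1)).2] at h2
      rw [hzero (k + 1) le_rfl, h2] at h1
      rw [show q.coeff k = 1 by linarith, one_mul]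
    · rw [hzero k (by omega), zero_mul]
  have e1 := split m (m + 1) (by omega)
  have e2 := split (m + 1) m le_rfl
  have e3 := split m m (by omega)
  have e4 := split (m + 1) (m + 1) (by omega)
  rw [mul_comm (P (m + 1)) (P m)] at e2
  simp only [if_true, show ¬ (m = m + 1 + 1) by omega, show ¬ (m = m + 1) by omega,
    show ¬ (m + 1 = m + 1 + 1) by omega, if_false, add_zero] at e1 e2 e3 e4
  have e5 : M (P m * P (m + 1)) - h m = (P (m + 1)).eval c * M (P m) := by linarith
  rw [e5, e1, e3, e4]
  ring

theorem continuousOn_genJacobiWeight {α β γ t : ℝ} (hα : 0 < α) (hβ : 0 < β) (ht : t < 0) :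
    ContinuousOn (genJacobiWeight α β γ t) (Set.Icc 0 1) := by
  unfold genJacobiWeight
  refine ContinuousOn.mul (ContinuousOn.mul ?_ ?_) ?_
  · exact ContinuousOn.rpow_const (by fun_prop) fun x hx => Or.inl (by linarith [hx.1])
  · exact ContinuousOn.rpow_const (by fun_prop) fun x _ => Or.inr hα.le
  · exact ContinuousOn.rpow_const (by fun_prop) fun x _ => Or.inr hβ.le

theorem intervalIntegrable_genJacobiWeight_div {α β γ t : ℝ} (hα : 0 < α) (hβ : 0 < β)
    (ht : t < 0) :
    IntervalIntegrable (fun y => genJacobiWeight α β γ t y / y) volume 0 1 := by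
  have h1 : IntervalIntegrable (fun y : ℝ => y ^ (α - 1)) volume 0 1 :=
    intervalIntegral.intervalIntegrable_rpow' (by linarith)
  have h2 : ContinuousOn (fun y : ℝ => (y - t) ^ γ * (1 - y) ^ β) (Set.uIcc 0 1) := by
    rw [Set.uIcc_of_le zero_le_one]
    refine ContinuousOn.mul ?_ ?_
    · exact ContinuousOn.rpow_const (by fun_prop) fun x hx => Or.inl (by linarith [hx.1])
    · exact ContinuousOn.rpow_const (by fun_prop) fun x _ => Or.inr hβ.le
  refine (h1.continuousOn_mul h2).congr fun y hy => ?_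
  rw [Set.uIoc_of_le zero_le_one] at hy
  simp only [genJacobiWeight, rpow_sub_one hy.1.ne']
  ring

theorem intervalIntegrable_genJacobiWeight_div_one_sub {α β γ t : ℝ} (hα : 0 < α)
    (hβ : 0 < β) (ht : t < 0) :
    IntervalIntegrable (fun y => genJacobiWeight α β γ t y / (1 - y)) volume 0 1 := by
  have h1 : IntervalIntegrable (fun y : ℝ => (1 - y) ^ (β - 1)) volume 0 1 := by
    have := (intervalIntegral.intervalIntegrable_rpow' (a := 0) (b := 1)
      (r := β - 1) (by linarith)).comp_sub_left 1
    simpa using this.symm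
  have h2 : ContinuousOn (fun y : ℝ => (y - t) ^ γ * y ^ α) (Set.uIcc 0 1) := by
    rw [Set.uIcc_of_le zero_le_one]
    refine ContinuousOn.mul ?_ ?_
    · exact ContinuousOn.rpow_const (by fun_prop) fun x hx => Or.inl (by linarith [hx.1])
    · exact ContinuousOn.rpow_const (by fun_prop) fun x _ => Or.inr hα.le
  have h3 := h1.continuousOn_mul h2
  refine h3.congr_ae ?_
  rw [Filter.EventuallyEq, ae_restrict_iff' measurableSet_uIoc]
  filter_upwards [Measure.ae_ne volume (1:ℝ)] with y hy1 hy
  rw [Set.uIoc_of_le zero_le_one] at hy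
  have : 1 - y ≠ 0 := sub_ne_zero.mpr (Ne.symm hy1)
  simp only [genJacobiWeight, rpow_sub_one this]
  ring

theorem intervalIntegrable_genJacobiWeight_div_sub {α β γ t : ℝ} (hα : 0 < α)
    (hβ : 0 < β) (ht : t < 0) :
    IntervalIntegrable (fun y => genJacobiWeight α β γ t y / (y - t)) volume 0 1 := by
  apply ContinuousOn.intervalIntegrable
  rw [Set.uIcc_of_le zero_le_one]
  exact (continuousOn_genJacobiWeight hα hβ ht).div (by fun_prop)
    fun x hx => by linarith [hx.1]

theorem hasDerivAt_genJacobiWeight {α β γ t x : ℝ} (ht : t < 0) (hx : x ∈ Set.Ioo (0:ℝ) 1) :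
    HasDerivAt (genJacobiWeight α β γ t)
      (γ * (genJacobiWeight α β γ t x / (x - t)) + α * (genJacobiWeight α β γ t x / x)
        - β * (genJacobiWeight α β γ t x / (1 - x))) x := by
  have ht' : x - t ≠ 0 := by linarith [hx.1]
  have h0 : x ≠ 0 := hx.1.ne'
  have h1 : 1 - x ≠ 0 := by linarith [hx.2]
  have d1 := ((hasDerivAt_id x).sub_const t).rpow_const (p := γ) (Or.inl ht')
  have d2 := (hasDerivAt_id x).rpow_const (p := α) (Or.inl h0)
  have d3 := ((hasDerivAt_id x).const_sub 1).rpow_const (p := β) (Or.inl h1)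
  refine ((d1.mul d2).mul d3).congr_deriv ?_
  simp only [id, genJacobiWeight, rpow_sub_one ht', rpow_sub_one h0, rpow_sub_one h1,
    Pi.mul_apply]
  ring

/-- Integration by parts against the generalized Jacobi weight. -/
theorem integral_derivative_mul_genJacobiWeight {α β γ t : ℝ} (hα : 0 < α) (hβ : 0 < β)
    (ht : t < 0) (p : Polynomial ℝ) :
    (∫ y in (0:ℝ)..1, p.derivative.eval y * genJacobiWeight α β γ t y)
      + γ * (∫ y in (0:ℝ)..1, p.eval y * (genJacobiWeight α β γ t y / (y - t)))
      + α * (∫ y in (0:ℝ)..1, p.eval y * (genJacobiWeight α β γ t y / y))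
      - β * (∫ y in (0:ℝ)..1, p.eval y * (genJacobiWeight α β γ t y / (1 - y))) = 0 := by
  have hc := continuousOn_genJacobiWeight (γ := γ) hα hβ ht
  have hw : IntervalIntegrable (genJacobiWeight α β γ t) volume 0 1 :=
    ContinuousOn.intervalIntegrable (by rwa [Set.uIcc_of_le zero_le_one])
  have i0 := hw.continuousOn_mul p.derivative.continuous.continuousOn
  have i1 := ((intervalIntegrable_genJacobiWeight_div_sub (γ := γ) hα hβ ht).continuousOn_mul
    p.continuous.continuousOn).const_mul γ
  have i2 := ((intervalIntegrable_genJacobiWeight_div (γ := γ) hα hβ ht).continuousOn_mul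
    p.continuous.continuousOn).const_mul α
  have i3 := ((intervalIntegrable_genJacobiWeight_div_one_sub (γ := γ) hα hβ ht).continuousOn_mul
    p.continuous.continuousOn).const_mul β
  have key := intervalIntegral.integral_eq_sub_of_hasDerivAt_of_le zero_le_one
    (p.continuous.continuousOn.mul hc)
    (f' := fun y => p.derivative.eval y * genJacobiWeight α β γ t y
      + γ * (p.eval y * (genJacobiWeight α β γ t y / (y - t)))
      + α * (p.eval y * (genJacobiWeight α β γ t y / y))
      - β * (p.eval y * (genJacobiWeight α β γ t y / (1 - y))))
    (fun x hx => ((p.hasDerivAt x).mul (hasDerivAt_genJacobiWeight ht hx)).congr_deriv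
      (by ring)) (((i0.add i1).add i2).sub i3)
  rw [intervalIntegral.integral_sub ((i0.add i1).add i2) i3,
    intervalIntegral.integral_add (i0.add i1) i2, intervalIntegral.integral_add i0 i1,
    intervalIntegral.integral_const_mul, intervalIntegral.integral_const_mul,
    intervalIntegral.integral_const_mul] at key
  rw [key]
  simp [genJacobiWeight, zero_rpow hα.ne', zero_rpow hβ.ne']

theorem statement10
    (α β γ t : ℝ) (hα : 0 < α) (hβ : 0 < β) (ht : t < 0)
    (P : ℕ → Polynomial ℝ) (h : ℕ → ℝ)
    (hmonic : ∀ n, (P n).Monic ∧ (P n).natDegree = n)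
    (hpos : ∀ n, 0 < h n)
    (horth : ∀ m n, (∫ x in (0:ℝ)..1,
        (P m).eval x * (P n).eval x * genJacobiWeight α β γ t x)
      = if m = n then h n else 0)
    (a b : ℕ → ℝ) (hb0 : b 0 = 0)
    (hrec : ∀ n, ∀ x : ℝ, x * (P n).eval x
      = (P (n + 1)).eval x + a n * (P n).eval x + b n * (P (n - 1)).eval x)
    (R Rs r rs : ℕ → ℝ)
    (hR : ∀ n, R n = β / h n *
      ∫ y in (0:ℝ)..1, ((P n).eval y) ^ 2 * genJacobiWeight α β γ t y / (1 - y))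
    (hRs : ∀ n, Rs n = α / h n *
      ∫ y in (0:ℝ)..1, ((P n).eval y) ^ 2 * genJacobiWeight α β γ t y / y)
    (hr : ∀ n, 1 ≤ n → r n = β / h (n - 1) *
      ∫ y in (0:ℝ)..1, (P (n - 1)).eval y * (P n).eval y * genJacobiWeight α β γ t y / (1 - y))
    (hrs : ∀ n, 1 ≤ n → rs n = α / h (n - 1) *
      ∫ y in (0:ℝ)..1, (P (n - 1)).eval y * (P n).eval y * genJacobiWeight α β γ t y / y)
    :
    ∀ n : ℕ, 1 ≤ n →
      (2 * n + β + γ) * r n - (2 * n + α + γ) * rs n + 2 * r n * rs n - n * (n + γ)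
        = b n * (R (n - 1) * Rs n + R n * Rs (n - 1)) := by
  intro n hn
  obtain ⟨m, rfl⟩ : ∃ m, n = m + 1 := ⟨n - 1, by omega⟩
  have hw : IntervalIntegrable (genJacobiWeight α β γ t) volume 0 1 :=
    ContinuousOn.intervalIntegrable (by
      rw [Set.uIcc_of_le zero_le_one]
      exact continuousOn_genJacobiWeight hα hβ ht)
  have h0 := intervalIntegrable_genJacobiWeight_div (γ := γ) hα hβ ht
  have h1 := intervalIntegrable_genJacobiWeight_div_one_sub (γ := γ) hα hβ ht
  have h2 := intervalIntegrable_genJacobiWeight_div_sub (γ := γ) hα hβ ht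
  set L := momentFunctional _ hw with hL
  set M₀ := momentFunctional _ h0 with hM₀
  set M₁ := momentFunctional _ h1 with hM₁
  set M₂ := momentFunctional _ h2 with hM₂
  have horthL : ∀ m n, L (P m * P n) = if m = n then h n else 0 := by
    intro m n
    rw [← horth m n, hL, momentFunctional_apply]
    simp only [Polynomial.eval_mul]
  have hparts : ∀ p : Polynomial ℝ,
      L p.derivative + γ * M₂ p + α * M₀ p - β * M₁ p = 0 :=
    integral_derivative_mul_genJacobiWeight hα hβ ht
  have hR' : ∀ k, R k = β / h k * M₁ (P k * P k) := by
    intro k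
    rw [hR, hM₁, momentFunctional_apply]
    simp only [Polynomial.eval_mul, pow_two, mul_div_assoc]
  have hRs' : ∀ k, Rs k = α / h k * M₀ (P k * P k) := by
    intro k
    rw [hRs, hM₀, momentFunctional_apply]
    simp only [Polynomial.eval_mul, pow_two, mul_div_assoc]
  have hr' : r (m + 1) = β / h m * M₁ (P m * P (m + 1)) := by
    rw [hr _ hn, hM₁, momentFunctional_apply]
    simp only [Polynomial.eval_mul, mul_div_assoc, Nat.add_sub_cancel]
  have hrs' : rs (m + 1) = α / h m * M₀ (P m * P (m + 1)) := by
    rw [hrs _ hn, hM₀, momentFunctional_apply]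
    simp only [Polynomial.eval_mul, mul_div_assoc, Nat.add_sub_cancel]
  have q0 := cauchy_functional_quadratic L M₀ 0
    (momentFunctional_X_sub_C_mul h0 hw 0 (fun y _ => by
      rcases eq_or_ne y 0 with rfl | hy
      · simp [genJacobiWeight, zero_rpow hα.ne']
      · rw [sub_zero, mul_div_cancel₀ _ hy])) hmonic horthL m
  have q1 := cauchy_functional_quadratic L (-M₁) 1
    (fun q => by
      have e := momentFunctional_X_sub_C_mul h1.neg hw 1 (fun y _ => by
        rcases eq_or_ne y 1 with rfl | hy
        · simp [genJacobiWeight, zero_rpow hβ.ne']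
        · have : 1 - y ≠ 0 := sub_ne_zero.mpr hy.symm
          simp only [Pi.neg_apply]
          field_simp
          ring) q
      rw [← e, hM₁, LinearMap.neg_apply, momentFunctional_apply, momentFunctional_apply,
        ← intervalIntegral.integral_neg]
      simp only [Pi.neg_apply, mul_neg]) hmonic horthL m
  have q2 := cauchy_functional_quadratic L M₂ t
    (momentFunctional_X_sub_C_mul h2 hw t (fun y hy => by
      have : y - t ≠ 0 := by linarith [hy.1]
      rw [mul_div_cancel₀ _ this])) hmonic horthL m
  simp only [LinearMap.neg_apply] at q1
  have hderiv : ∀ k l, k ≤ l + 1 →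
      L ((P k).derivative * P l) = if k = l + 1 then k * h l else 0 := by
    intro k l hkl
    have hdeg : (P k).derivative.degree < k := by
      rw [Polynomial.degree_lt_iff_coeff_zero]
      intro i hi
      rw [Polynomial.coeff_derivative,
        Polynomial.coeff_eq_zero_of_natDegree_lt ((hmonic k).2.trans_lt (by omega)), zero_mul]
    rw [functional_mul_orthogonal L hmonic horthL l k hkl _ hdeg, Polynomial.coeff_derivative]
    split_ifs with hk
    · subst hk
      have := (hmonic (l + 1)).1.coeff_natDegree
      rw [(hmonic (l + 1)).2] at this
      rw [this]
      push_cast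
      ring
    · rw [Polynomial.coeff_eq_zero_of_natDegree_lt ((hmonic k).2.trans_lt (by omega))]
      simp
  have hdiag : ∀ k, γ * M₂ (P k * P k) + α * M₀ (P k * P k) - β * M₁ (P k * P k) = 0 := by
    intro k
    have e := hparts (P k * P k)
    rw [Polynomial.derivative_mul, mul_comm (P k) (P k).derivative, map_add,
      hderiv k k (by omega), if_neg (by omega)] at e
    linarith
  have hoff : (m + 1) * h m + γ * M₂ (P m * P (m + 1)) + α * M₀ (P m * P (m + 1))
      - β * M₁ (P m * P (m + 1)) = 0 := by
    have e := hparts (P m * P (m + 1))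
    rw [Polynomial.derivative_mul, mul_comm (P m) (P (m + 1)).derivative, map_add,
      hderiv m (m + 1) (by omega), if_neg (by omega), hderiv (m + 1) m le_rfl,
      if_pos rfl] at e
    push_cast at e
    linarith
  have hb : b (m + 1) * h m = h (m + 1) := by
    have hpoly : Polynomial.X * P (m + 1) = P (m + 2) + a (m + 1) • P (m + 1)
        + b (m + 1) • P m := by
      refine Polynomial.funext fun x => ?_
      have := hrec (m + 1) x
      simpa using this
    have e1 : L (P m * (Polynomial.X * P (m + 1))) = b (m + 1) * h m := by
      rw [hpoly, mul_add, mul_add, mul_smul_comm, mul_smul_comm]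
      simp [horthL]
    have hlead := (hmonic m).1.coeff_natDegree
    rw [(hmonic m).2] at hlead
    have hdeg : (Polynomial.X * P m).degree < ((m + 2 : ℕ) : WithBot ℕ) := by
      rw [Polynomial.degree_lt_iff_coeff_zero]
      intro i hi
      obtain ⟨j, rfl⟩ : ∃ j, i = j + 1 := ⟨i - 1, by omega⟩
      rw [Polynomial.coeff_X_mul,
        Polynomial.coeff_eq_zero_of_natDegree_lt ((hmonic m).2.trans_lt (by omega))]
    have e2 := functional_mul_orthogonal L hmonic horthL (m + 1) (m + 2) le_rfl _ hdeg
    rw [Polynomial.coeff_X_mul, hlead, one_mul] at e2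
    rw [← e1, ← e2]
    congr 1
    ring
  have hm := (hpos m).ne'
  have hm1 := (hpos (m + 1)).ne'
  have hbm : b (m + 1) = h (m + 1) / h m := by rw [← hb]; field_simp
  have d1 := hdiag m
  have d2 := hdiag (m + 1)
  rw [hr', hrs', Nat.add_sub_cancel, hR' m, hR' (m + 1), hRs' m, hRs' (m + 1), hbm]
  generalize M₀ (P m * P (m + 1)) = I₀ at *
  generalize M₁ (P m * P (m + 1)) = I₁ at *
  generalize M₂ (P m * P (m + 1)) = I₂ at *
  generalize M₀ (P m * P m) = A₀ at *
  generalize M₁ (P m * P m) = A₁ at *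
  generalize M₂ (P m * P m) = A₂ at *
  generalize M₀ (P (m + 1) * P (m + 1)) = B₀ at *
  generalize M₁ (P (m + 1) * P (m + 1)) = B₁ at *
  generalize M₂ (P (m + 1) * P (m + 1)) = B₂ at *
  have hA : γ * A₂ = β * A₁ - α * A₀ := by linarith
  have hB : γ * B₂ = β * B₁ - α * B₀ := by linarith
  have hI : γ * I₂ = β * I₁ - α * I₀ - (m + 1) * h m := by linarith
  have hprod : (γ * I₂) * (γ * I₂ - γ * h m) = (γ * B₂) * (γ * A₂) := by
    linear_combination γ ^ 2 * q2
  rw [hA, hB, hI] at hprod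
  push_cast
  field_simp
  linear_combination α ^ 2 * q0 + β ^ 2 * q1 - hprod
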